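/- Let 0 < p < 1 and let f be the martingale constructed from (α_k). Then there exists an absolute constant c > 0 such that for every k ≥ 1 and every j ∈ N_{n_0} with M_{α_k} ≤ j < M_{α_k+1}, the weak L_p quasinorm satisfies ‖S_j f‖_{L_{p,∞}} ≥ c · M_{α_k}^{1/p−1} / Φ_{M_{α_k}}^{1/4}. -/

import Mathlib

open MeasureTheory Filter Finset
open scoped Classical ENNReal NNReal

noncomputable section

namespace VilenkinPaper

/-- The generalized powers `M_0 = 1`, `M_{k+1} = m_k M_k`. -/
def Mseq (m : ℕ → ℕ) : ℕ → ℕ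
  | 0 => 1
  | k + 1 => m k * Mseq m k

/-- The Vilenkin group `G_m = ∏_k ℤ_{m_k}`. -/
abbrev Gm (m : ℕ → ℕ) : Type := (k : ℕ) → ZMod (m k)

/-- The `j`-th digit of `n` in the generalized number system based on `m`. -/
def digit (m : ℕ → ℕ) (n j : ℕ) : ℕ := n / Mseq m j % m j

/-- The generalized Rademacher functions `r_k(x) = exp(2πi x_k / m_k)`. -/
def rad (m : ℕ → ℕ) (k : ℕ) (x : Gm m) : ℂ :=
  Complex.exp (2 * Real.pi * Complex.I * ((x k).val : ℂ) / (m k : ℂ))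

/-- The Vilenkin system `ψ_n = ∏_k r_k^{n_k}`. -/
def psi (m : ℕ → ℕ) (n : ℕ) (x : Gm m) : ℂ := ∏ᶠ k : ℕ, rad m k x ^ digit m n k

/-- The Dirichlet kernels `D_n = ∑_{k<n} ψ_k`. -/
def Dker (m : ℕ → ℕ) (n : ℕ) (x : Gm m) : ℂ := ∑ k ∈ Finset.range n, psi m k x

/-- The interval `I_n(x)` : all `y` agreeing with `x` on the first `n` coordinates. -/
def Iset (m : ℕ → ℕ) (n : ℕ) (x : Gm m) : Set (Gm m) := {y | ∀ k < n, y k = x k}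

/-- `I_n := I_n(0)`. -/
def IsetO (m : ℕ → ℕ) (n : ℕ) : Set (Gm m) := Iset m n 0

/-- `μ` is the normalized Haar (product) measure iff every interval `I_n(x)` has
measure `1 / M_n`. -/
def IsHaarGm (m : ℕ → ℕ) (μ : Measure (Gm m)) : Prop :=
  ∀ n x, μ (Iset m n x) = ((Mseq m n : ℝ≥0∞))⁻¹

/-- The σ-algebra `F_n` generated by the intervals `{I_n(x)}`, i.e. by the first `n`
coordinates. -/
def filt (m : ℕ → ℕ) (n : ℕ) : MeasurableSpace (Gm m) :=
  MeasurableSpace.comap (fun x (k : Fin n) => x k) ⊤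

/-- A (Vilenkin) martingale with respect to the filtration `F_n`. -/
def IsVMartingale (m : ℕ → ℕ) (μ : Measure (Gm m)) (f : ℕ → Gm m → ℂ) : Prop :=
  (∀ n, Integrable (f n) μ) ∧
  (∀ n, Measurable[filt m n] (f n)) ∧
  (∀ n N, n ≤ N → μ[f N | filt m n] =ᵐ[μ] f n)

/-- Membership in the martingale Hardy space `H_p`: the maximal function
`f* = sup_n |f^{(n)}|` belongs to `L_p`. -/
def MemHp (m : ℕ → ℕ) (μ : Measure (Gm m)) (p : ℝ) (f : ℕ → Gm m → ℂ) : Prop :=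
  ∫⁻ x, (⨆ n, (‖f n x‖₊ : ℝ≥0∞)) ^ p ∂μ < ⊤

/-- The `i`-th Vilenkin–Fourier coefficient of an integrable function. -/
def fourierCoefFn (m : ℕ → ℕ) (μ : Measure (Gm m)) (g : Gm m → ℂ) (i : ℕ) : ℂ :=
  ∫ x, g x * (starRingEnd ℂ) (psi m i x) ∂μ

/-- The partial sum `S_n` built from a sequence `c` of Fourier coefficients. -/
def Spart (m : ℕ → ℕ) (c : ℕ → ℂ) (n : ℕ) (x : Gm m) : ℂ :=
  ∑ k ∈ Finset.range n, c k * psi m k x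

/-- The weak `L_{p,∞}` quasinorm `sup_{λ>0} λ μ(|g| > λ)^{1/p}`. -/
def wLp (m : ℕ → ℕ) (μ : Measure (Gm m)) (p : ℝ) (g : Gm m → ℂ) : ℝ≥0∞ :=
  ⨆ (t : ℝ) (_ : 0 < t), ENNReal.ofReal t * μ {x | t < ‖g x‖} ^ (1 / p)

/-- `|n| = max {j : n_j ≠ 0}`. -/
def maxDigit (m : ℕ → ℕ) (n : ℕ) : ℕ := sSup {j | digit m n j ≠ 0}

/-- The set `ℕ_{n_0}` of positive integers with `n_0 = n_{|n|} = 1`. -/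
def Nn0 (m : ℕ → ℕ) : Set ℕ :=
  {n | 0 < n ∧ digit m n 0 = 1 ∧ digit m n (maxDigit m n) = 1}

/-- The atom `a = (M_α^{1/p-1}/M) (D_{M_{α+1}} - D_{M_α})`. -/
def atomFun (m : ℕ → ℕ) (MM : ℕ) (p : ℝ) (a : ℕ) (x : Gm m) : ℂ :=
  (((Mseq m a : ℝ) ^ (1 / p - 1) / (MM : ℝ) : ℝ) : ℂ) *
    (Dker m (Mseq m (a + 1)) x - Dker m (Mseq m a) x)

/-- The coefficients `λ_k = Φ_{M_{α_k}}^{-1/4}`. -/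
def lamSeq (m : ℕ → ℕ) (Φ : ℕ → ℝ) (α : ℕ → ℕ) (k : ℕ) : ℝ :=
  Φ (Mseq m (α k)) ^ (-(1 / 4 : ℝ))

/-- The martingale `f^{(A)} = ∑_{k : α_k < A} λ_k a_k` of the counterexample construction. -/
def fCon (m : ℕ → ℕ) (MM : ℕ) (p : ℝ) (Φ : ℕ → ℝ) (α : ℕ → ℕ) (A : ℕ) (x : Gm m) : ℂ :=
  ∑ᶠ (k : ℕ) (_ : α k < A), (lamSeq m Φ α k : ℂ) * atomFun m MM p (α k) x

section Digits

variable {m : ℕ → ℕ}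

lemma Mseq_pos (hm : ∀ k, 2 ≤ m k) (k : ℕ) : 0 < Mseq m k := by
  induction k with
  | zero => exact Nat.one_pos
  | succ k ih => exact Nat.mul_pos (by linarith [hm k]) ih

lemma strictMono_Mseq (hm : ∀ k, 2 ≤ m k) : StrictMono (Mseq m) := by
  refine strictMono_nat_of_lt_succ fun k => ?_
  have h := Mseq_pos hm k
  have := Nat.mul_le_mul_right (Mseq m k) (hm k)
  change Mseq m k < m k * Mseq m k
  lia

lemma lt_Mseq_self (hm : ∀ k, 2 ≤ m k) (n : ℕ) : n < Mseq m n := by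
  induction n with
  | zero => exact Nat.one_pos
  | succ n ih => exact Nat.lt_of_le_of_lt ih (strictMono_Mseq hm n.lt_succ_self)

lemma dvd_Mseq {k : ℕ} (hk : 1 ≤ k) : m 0 ∣ Mseq m k := by
  induction k, hk using Nat.le_induction with
  | base => exact ⟨1, rfl⟩
  | succ k _ ih => exact ih.mul_left _

lemma digit_eq_zero (hm : ∀ k, 2 ≤ m k) {n N k : ℕ} (hn : n < Mseq m N) (hk : N ≤ k) :
    digit m n k = 0 := by
  rw [digit, Nat.div_eq_of_lt (hn.trans_le ((strictMono_Mseq hm).monotone hk)), Nat.zero_mod]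

lemma mod_Mseq_eq_of_digit_eq {n i N : ℕ} (h : ∀ k < N, digit m n k = digit m i k) :
    n % Mseq m N = i % Mseq m N := by
  induction N with
  | zero => simp [Mseq, Nat.mod_one]
  | succ N ih =>
    have hN := h N N.lt_succ_self
    simp only [digit] at hN
    rw [show Mseq m (N + 1) = Mseq m N * m N from mul_comm _ _, Nat.mod_mul, Nat.mod_mul,
      ih fun k hk => h k (hk.trans N.lt_succ_self), hN]

lemma exists_digit_ne {n i N : ℕ} (hn : n < Mseq m N) (hi : i < Mseq m N) (hni : n ≠ i) :
    ∃ k < N, digit m n k ≠ digit m i k := by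
  by_contra! h
  have := mod_Mseq_eq_of_digit_eq h
  rw [Nat.mod_eq_of_lt hn, Nat.mod_eq_of_lt hi] at this
  exact hni this

lemma digit_mul_add_zero {q r : ℕ} (hr : r < m 0) : digit m (m 0 * q + r) 0 = r := by
  simp [digit, Mseq, Nat.mod_eq_of_lt hr]

lemma digit_mul_add_succ {q r : ℕ} (hr : r < m 0) (k : ℕ) :
    digit m (m 0 * q + r) (k + 1) = digit m (m 0 * q) (k + 1) := by
  obtain ⟨t, ht⟩ := dvd_Mseq (m := m) (Nat.le_add_left 1 k)
  have h0 : 0 < m 0 := by lia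
  rw [digit, digit, ht, ← Nat.div_div_eq_div_mul, ← Nat.div_div_eq_div_mul,
    Nat.mul_add_div h0, Nat.div_eq_of_lt hr, add_zero, Nat.mul_div_cancel_left _ h0]

lemma Mseq_le_iff_of_div_eq {a i i' : ℕ} (ha : 1 ≤ a) (h0 : 0 < m 0) (h : i / m 0 = i' / m 0) :
    Mseq m a ≤ i ↔ Mseq m a ≤ i' := by
  obtain ⟨t, ht⟩ := dvd_Mseq (m := m) ha
  rw [ht, mul_comm, ← Nat.le_div_iff_mul_le h0, ← Nat.le_div_iff_mul_le h0, h]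

end Digits

section Characters

variable {m : ℕ → ℕ}

lemma rad_eq_stdAddChar [∀ k, NeZero (m k)] (k : ℕ) (x : Gm m) :
    rad m k x = ZMod.stdAddChar (x k) := by
  rw [rad, ZMod.stdAddChar_apply, ZMod.toCircle_apply]

lemma norm_rad [∀ k, NeZero (m k)] (k : ℕ) (x : Gm m) : ‖rad m k x‖ = 1 := by
  rw [rad_eq_stdAddChar, AddChar.norm_apply]

lemma psi_eq_prod (hm : ∀ k, 2 ≤ m k) {n N : ℕ} (hn : n < Mseq m N) (x : Gm m) :
    psi m n x = ∏ k ∈ range N, rad m k x ^ digit m n k := by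
  refine finprod_eq_prod_of_mulSupport_subset _ fun k hk => ?_
  by_contra h
  simp only [coe_range, Set.mem_Iio, not_lt] at h
  exact hk (by simp [digit_eq_zero hm hn h])

lemma norm_psi [∀ k, NeZero (m k)] (hm : ∀ k, 2 ≤ m k) (n : ℕ) (x : Gm m) :
    ‖psi m n x‖ = 1 := by
  rw [psi_eq_prod hm (lt_Mseq_self hm n), norm_prod]
  exact prod_eq_one fun k _ => by rw [norm_pow, norm_rad, one_pow]

lemma psi_mul_add (hm : ∀ k, 2 ≤ m k) {q r : ℕ} (hr : r < m 0) (x : Gm m) :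
    psi m (m 0 * q + r) x = rad m 0 x ^ r * psi m (m 0 * q) x := by
  have h := (Nat.le_add_right _ _).trans_lt
    ((lt_Mseq_self hm (m 0 * q + r)).trans (strictMono_Mseq hm (Nat.lt_succ_self _)))
  rw [psi_eq_prod hm h, psi_eq_prod hm
    ((lt_Mseq_self hm (m 0 * q + r)).trans (strictMono_Mseq hm (Nat.lt_succ_self _))),
    prod_range_succ', prod_range_succ', digit_mul_add_zero hr,
    show digit m (m 0 * q) 0 = 0 by simp [digit, Mseq], pow_zero, mul_one, mul_comm]
  congr 1
  exact prod_congr rfl fun k _ => by rw [digit_mul_add_succ hr]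

lemma sum_psi_block [∀ k, NeZero (m k)] (hm : ∀ k, 2 ≤ m k) (q : ℕ) {x : Gm m} (hx : x 0 ≠ 0) :
    ∑ r ∈ range (m 0), psi m (m 0 * q + r) x = 0 := by
  rw [sum_congr rfl fun r hr => psi_mul_add hm (mem_range.1 hr) x, ← sum_mul]
  have h1 : rad m 0 x ≠ 1 := by
    rw [rad_eq_stdAddChar]
    intro h
    exact hx (ZMod.injective_stdAddChar (h.trans (AddChar.map_zero_eq_one _).symm))
  have h2 : rad m 0 x ^ m 0 = 1 := by
    rw [rad_eq_stdAddChar, ← AddChar.map_nsmul_eq_pow]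
    simp
  rw [geom_sum_eq h1, h2, sub_self, zero_div, zero_mul]

/-- Off `I_1`, partial sums with coefficients constant on blocks of length `m 0` telescope. -/
lemma Spart_mul_eq_zero [∀ k, NeZero (m k)] (hm : ∀ k, 2 ≤ m k) {c : ℕ → ℂ}
    (hc : ∀ q, ∀ r < m 0, c (m 0 * q + r) = c (m 0 * q)) (q : ℕ) {x : Gm m} (hx : x 0 ≠ 0) :
    Spart m c (m 0 * q) x = 0 := by
  induction q with
  | zero => simp [Spart]
  | succ q ih =>
    rw [Spart, Nat.mul_succ, sum_range_add]
    rw [Spart] at ih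
    rw [ih, zero_add, sum_congr rfl fun r hr => by rw [hc q r (mem_range.1 hr)], ← mul_sum,
      sum_psi_block hm q hx, mul_zero]

end Characters

section Orthogonality

variable {m : ℕ → ℕ} {μ : Measure (Gm m)}

lemma IsHaarGm.isProbabilityMeasure (hμ : IsHaarGm m μ) : IsProbabilityMeasure μ :=
  ⟨by simpa [Iset, Mseq] using hμ 0 0⟩

lemma integral_cylinder [∀ k, NeZero (m k)] (hμ : IsHaarGm m μ) (N : ℕ)
    (G : ((k : Fin N) → ZMod (m k)) → ℂ) :
    ∫ x, G (fun k => x k) ∂μ = (Mseq m N : ℂ)⁻¹ * ∑ y, G y := by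
  have := hμ.isProbabilityMeasure
  have hπ : Measurable fun (x : Gm m) (k : Fin N) => x k := by fun_prop
  have : IsProbabilityMeasure (μ.map fun (x : Gm m) (k : Fin N) => x k) :=
    Measure.isProbabilityMeasure_map hπ.aemeasurable
  have hG : Integrable G (μ.map fun (x : Gm m) (k : Fin N) => x k) := .of_finite
  rw [← integral_map hπ.aemeasurable hG.aestronglyMeasurable, integral_fintype hG, mul_sum]
  refine sum_congr rfl fun y _ => ?_
  have hy : (fun (x : Gm m) (k : Fin N) => x k) ⁻¹' {y} =
      Iset m N fun k => if h : k < N then y ⟨k, h⟩ else 0 := by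
    ext x
    simp only [Set.mem_preimage, Set.mem_singleton_iff, funext_iff, Iset, Set.mem_ofPred_eq]
    refine ⟨fun h k hk => by simpa [hk] using h ⟨k, hk⟩, fun h k => by simpa using h k k.2⟩
  rw [measureReal_def, Measure.map_apply hπ (measurableSet_singleton y), hy, hμ,
    Complex.real_smul]
  simp

/-- The difference of the `k`-th digits of `n` and `i`, modulo `m k`. -/
def digitDiff (m : ℕ → ℕ) (n i k : ℕ) : ZMod (m k) := (digit m n k : ZMod (m k)) - digit m i k

lemma psi_mul_conj_psi_eq_prod [∀ k, NeZero (m k)] (hm : ∀ k, 2 ≤ m k) {n i N : ℕ}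
    (hn : n < Mseq m N) (hi : i < Mseq m N) (x : Gm m) :
    psi m n x * (starRingEnd ℂ) (psi m i x) =
      ∏ k : Fin N, ZMod.stdAddChar (x k * digitDiff m n i k) := by
  rw [psi_eq_prod hm hn, psi_eq_prod hm hi, map_prod, ← prod_mul_distrib,
    ← Fin.prod_univ_eq_prod_range
      (fun k => rad m k x ^ digit m n k * (starRingEnd ℂ) (rad m k x ^ digit m i k))]
  refine prod_congr rfl fun k _ => ?_
  rw [rad_eq_stdAddChar, digitDiff, mul_sub, sub_eq_add_neg, AddChar.map_add_eq_mul, map_pow,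
    ← AddChar.map_neg_eq_conj, ← AddChar.map_nsmul_eq_pow, ← AddChar.map_nsmul_eq_pow]
  simp [mul_comm]

lemma integral_psi_mul_conj_psi [∀ k, NeZero (m k)] (hm : ∀ k, 2 ≤ m k) (hμ : IsHaarGm m μ)
    (n i : ℕ) :
    ∫ x, psi m n x * (starRingEnd ℂ) (psi m i x) ∂μ = if n = i then 1 else 0 := by
  have := hμ.isProbabilityMeasure
  split_ifs with h
  · simp [h, Complex.mul_conj', norm_psi hm]
  have hn := (lt_Mseq_self hm n).trans_le ((strictMono_Mseq hm).monotone (le_max_left n i))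
  have hi := (lt_Mseq_self hm i).trans_le ((strictMono_Mseq hm).monotone (le_max_right n i))
  obtain ⟨k, hk, hne⟩ := exists_digit_ne hn hi h
  rw [integral_congr_ae (.of_forall fun x => psi_mul_conj_psi_eq_prod hm hn hi x),
    integral_cylinder hμ _ fun y => ∏ k : Fin (max n i),
      ZMod.stdAddChar (y k * digitDiff m n i k)]
  have hprod := prod_univ_sum (fun k : Fin (max n i) => (univ : Finset (ZMod (m k))))
    fun k y => (ZMod.stdAddChar (y * digitDiff m n i k) : ℂ)
  rw [Fintype.piFinset_univ] at hprod
  rw [← hprod, prod_eq_zero (mem_univ ⟨k, hk⟩), mul_zero]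
  have hlt : ∀ n, digit m n k < m k := fun n => Nat.mod_lt _ (by linarith [hm k])
  rw [AddChar.sum_mulShift _ (ZMod.isPrimitive_stdAddChar _), if_neg, Nat.cast_zero]
  intro h0
  rw [digitDiff, sub_eq_zero, ZMod.natCast_eq_natCast_iff', Nat.mod_eq_of_lt (hlt n),
    Nat.mod_eq_of_lt (hlt i)] at h0
  exact hne h0

lemma integrable_psi_mul_conj_psi [∀ k, NeZero (m k)] (hm : ∀ k, 2 ≤ m k) (hμ : IsHaarGm m μ)
    (n i : ℕ) : Integrable (fun x => psi m n x * (starRingEnd ℂ) (psi m i x)) μ := by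
  have := hμ.isProbabilityMeasure
  have hn := (lt_Mseq_self hm n).trans_le ((strictMono_Mseq hm).monotone (le_max_left n i))
  have hi := (lt_Mseq_self hm i).trans_le ((strictMono_Mseq hm).monotone (le_max_right n i))
  refine Integrable.of_bound (C := 1) ?_ (.of_forall fun x => by simp [norm_psi hm])
  rw [funext fun x => psi_mul_conj_psi_eq_prod hm hn hi x]
  have hπ : Measurable fun (x : Gm m) (k : Fin (max n i)) => x k := by fun_prop
  exact ((measurable_of_finite fun y : (k : Fin (max n i)) → ZMod (m k) =>
    ∏ k, (ZMod.stdAddChar (y k * digitDiff m n i k) : ℂ)).comp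
      hπ).aestronglyMeasurable

end Orthogonality

section Coefficients

variable {m : ℕ → ℕ} {μ : Measure (Gm m)}

lemma atomFun_eq_sum (hm : ∀ k, 2 ≤ m k) (MM : ℕ) (p : ℝ) (a : ℕ) (x : Gm m) :
    atomFun m MM p a x = ∑ n ∈ Ico (Mseq m a) (Mseq m (a + 1)),
      (((Mseq m a : ℝ) ^ (1 / p - 1) / (MM : ℝ) : ℝ) : ℂ) * psi m n x := by
  rw [atomFun, ← mul_sum, sum_Ico_eq_sub _ ((strictMono_Mseq hm).monotone a.le_succ)]
  rfl

lemma fCon_eq_sum {MM : ℕ} {p : ℝ} {Φ : ℕ → ℝ} {α : ℕ → ℕ} (hα : StrictMono α) (A : ℕ)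
    (x : Gm m) :
    fCon m MM p Φ α A x = ∑ k ∈ range A with α k < A,
      (lamSeq m Φ α k : ℂ) * atomFun m MM p (α k) x := by
  refine finsum_cond_eq_sum_of_cond_iff _ fun {k} _ => ?_
  simp only [mem_filter, mem_range, iff_and_self]
  exact (hα.le_apply).trans_lt

lemma fourierCoefFn_fCon [∀ k, NeZero (m k)] (hm : ∀ k, 2 ≤ m k) (hμ : IsHaarGm m μ)
    {MM : ℕ} {p : ℝ} {Φ : ℕ → ℝ} {α : ℕ → ℕ} (hα : StrictMono α) (A i : ℕ) :
    fourierCoefFn m μ (fCon m MM p Φ α A) i = ∑ k ∈ range A with α k < A,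
      if Mseq m (α k) ≤ i ∧ i < Mseq m (α k + 1) then
        (lamSeq m Φ α k : ℂ) * (((Mseq m (α k) : ℝ) ^ (1 / p - 1) / (MM : ℝ) : ℝ) : ℂ)
      else 0 := by
  have hint := integrable_psi_mul_conj_psi hm hμ
  simp only [fourierCoefFn, fCon_eq_sum hα, atomFun_eq_sum hm, sum_mul, mul_sum, mul_assoc]
  rw [integral_finsetSum _ fun k _ => integrable_finsetSum _ fun n _ =>
    ((hint n i).const_mul _).const_mul _]
  refine sum_congr rfl fun k _ => ?_
  rw [integral_finsetSum _ fun n _ => ((hint n i).const_mul _).const_mul _]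
  simp only [integral_const_mul, integral_psi_mul_conj_psi hm hμ]
  simp [mem_Ico]

end Coefficients

lemma ofReal_mul_le_wLp {m : ℕ → ℕ} {μ : Measure (Gm m)} {p : ℝ} (hp : 0 < p) {g : Gm m → ℂ}
    {t δ : ℝ} (ht : 0 < t) (hδ : 0 ≤ δ) {s : Set (Gm m)} (hs : ENNReal.ofReal δ ≤ μ s)
    (hg : ∀ x ∈ s, t < ‖g x‖) :
    ENNReal.ofReal (t * δ ^ (1 / p)) ≤ wLp m μ p g := by
  refine le_trans ?_ (le_iSup₂ (f := fun (t : ℝ) (_ : 0 < t) =>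
    ENNReal.ofReal t * μ {x | t < ‖g x‖} ^ (1 / p)) t ht)
  rw [ENNReal.ofReal_mul ht.le, ← ENNReal.ofReal_rpow_of_nonneg hδ (by positivity)]
  gcongr
  exact hs.trans (measure_mono hg)

theorem statement15 (m : ℕ → ℕ) (hm : ∀ k, 2 ≤ m k)
    (MM : ℕ) (hMM : IsLUB (Set.range m) MM)
    (μ : Measure (Gm m)) (hμ : IsHaarGm m μ)
    (p : ℝ) (hp0 : 0 < p) (hp1 : p < 1)
    (Φ : ℕ → ℝ) (hΦpos : ∀ n, 0 < Φ n) (hΦmono : Monotone Φ)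
    (hΦtop : Tendsto Φ atTop atTop)
    (α : ℕ → ℕ) (hα : StrictMono α) (hα2 : ∀ k, 2 ≤ α k)
    (hsum : Summable fun k => Φ (Mseq m (α k)) ^ (-(p / 4) : ℝ))
    (c : ℕ → ℂ)
    (hc : ∀ i, Tendsto (fun k => fourierCoefFn m μ (fCon m MM p Φ α k) i) atTop (nhds (c i))) :
    ∃ C : ℝ, 0 < C ∧ ∀ k j, j ∈ Nn0 m → Mseq m (α k) ≤ j → j < Mseq m (α k + 1) →
      ENNReal.ofReal (C * (Mseq m (α k) : ℝ) ^ (1 / p - 1) / Φ (Mseq m (α k)) ^ ((1 : ℝ) / 4)) ≤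
        wLp m μ p (Spart m c j) := by
  have : ∀ k, NeZero (m k) := fun k => ⟨by linarith [hm k]⟩
  have hm0 : 0 < m 0 := by linarith [hm 0]
  have hMM0 : 0 < MM := hm0.trans_le (hMM.1 ⟨0, rfl⟩)
  have hα1 : ∀ k, 1 ≤ α k := fun k => one_le_two.trans (hα2 k)
  simp only [fourierCoefFn_fCon hm hμ hα] at hc
  have hblock : ∀ q, ∀ r < m 0, c (m 0 * q + r) = c (m 0 * q) := by
    intro q r hr
    have hdiv : (m 0 * q + r) / m 0 = m 0 * q / m 0 := by
      rw [Nat.mul_add_div hm0, Nat.div_eq_of_lt hr, add_zero, Nat.mul_div_cancel_left _ hm0]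
    refine tendsto_nhds_unique (hc _) ((hc (m 0 * q)).congr fun A => sum_congr rfl fun k _ => ?_)
    simp only [← not_le, Mseq_le_iff_of_div_eq (hα1 k) hm0 hdiv,
      Mseq_le_iff_of_div_eq (Nat.le_add_left 1 (α k)) hm0 hdiv]
  have hcoef : ∀ k i, Mseq m (α k) ≤ i → i < Mseq m (α k + 1) → c i =
      (lamSeq m Φ α k : ℂ) * (((Mseq m (α k) : ℝ) ^ (1 / p - 1) / (MM : ℝ) : ℝ) : ℂ) := by
    intro k i hki hik
    refine tendsto_nhds_unique (hc i) (tendsto_const_nhds.congr' ?_)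
    filter_upwards [eventually_gt_atTop (α k)] with A hA
    rw [sum_eq_single_of_mem k (by simp [hA, hα.le_apply.trans_lt hA]), if_pos ⟨hki, hik⟩]
    intro l _ hlk
    refine if_neg fun ⟨h1, h2⟩ => hlk (hα.injective ?_)
    have h3 := (strictMono_Mseq hm).lt_iff_lt.1 (h1.trans_lt hik)
    have h4 := (strictMono_Mseq hm).lt_iff_lt.1 (hki.trans_lt h2)
    lia
  refine ⟨1 / (2 * MM) * (m 0 : ℝ)⁻¹ ^ (1 / p), by positivity, fun k j hj hkj hjk => ?_⟩
  obtain ⟨q, rfl⟩ : ∃ q, j = m 0 * q + 1 :=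
    have h1 : j % m 0 = 1 := by simpa [digit, Mseq] using hj.2.1
    ⟨j / m 0, by rw [← h1, Nat.div_add_mod]⟩
  have hq : Mseq m (α k) ≤ m 0 * q := by
    have hdiv : (m 0 * q + 1) / m 0 = m 0 * q / m 0 := by
      rw [Nat.mul_add_div hm0, Nat.div_eq_of_lt (hm 0), add_zero, Nat.mul_div_cancel_left _ hm0]
    exact (Mseq_le_iff_of_div_eq (hα1 k) hm0 hdiv).1 hkj
  have hΦk : 0 < Φ (Mseq m (α k)) := hΦpos _
  have hMk : 0 < (Mseq m (α k) : ℝ) := by exact_mod_cast Mseq_pos hm _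
  set B : ℝ := lamSeq m Φ α k * ((Mseq m (α k) : ℝ) ^ (1 / p - 1) / MM) with hB
  have hBpos : 0 < B := by unfold B lamSeq; positivity
  convert ofReal_mul_le_wLp (m := m) (μ := μ) hp0 (half_pos hBpos) (δ := (m 0 : ℝ)⁻¹)
    (s := Iset m 1 fun _ => 1) (by positivity) ?_ ?_ using 2
  · rw [hB, lamSeq, Real.rpow_neg hΦk.le]
    field_simp
  · rw [hμ, ENNReal.ofReal_inv_of_pos (by positivity)]
    simp [Mseq]
  · intro x hx
    have hx0 : x 0 ≠ 0 := by
      have : Fact (1 < m 0) := ⟨hm 0⟩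
      rw [hx 0 one_pos]
      exact one_ne_zero
    have hzero := Spart_mul_eq_zero hm hblock q hx0
    rw [Spart] at hzero
    rw [Spart, sum_range_succ, hzero, zero_add, norm_mul, norm_psi hm, mul_one,
      hcoef k _ hq ((Nat.lt_succ_self _).trans hjk), ← Complex.ofReal_mul, Complex.norm_real,
      Real.norm_of_nonneg hBpos.le]
    exact half_lt_self hBpos

end VilenkinPaper
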